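/- arXiv:1909.00909 — 11 statements merged into one kernel-verified Lean document; each statement's English description precedes it below -/
import Mathlib

section
/- Let n ≥ 3 be an integer. There exists ε = ε(n) ∈ (0,1) with the following property: for every a > 0 and every smooth function f : [0,a] → ℝ with f(0) = f(a) = 0 and f(t) > 0 for t ∈ (0,a), if on (0,a) the inequalities (1) -f''(t)/f(t) ≥ ε, (2) (n-2)/f(t)² - f''(t)/f(t) - (n-2)·f'(t)²/f(t)² ≥ (n-1)ε, and (3) -2f''(t)/f(t) + (n-2)/f(t)² - (n-2)·f'(t)²/f(t)² ≥ n all hold, then ∫₀ᵃ f(t)^{n-1} dt ≤ ∫₀^π (sin t)^{n-1} dt. -/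
open Real intervalIntegral Set

lemma aux_pt (y w p s : ℝ) (hy : 0 < y) (hw : 0 ≤ w) (hp : 1/2 ≤ p)
    (h : y * (1 - p^2) ≤ w) (hs : 2 * w ≤ s ∨ 4 * w^2 ≤ s * y) :
    y ≤ (y + w/2 + s) * p := by
  obtain ⟨u, rfl⟩ : ∃ u, w = y * u := ⟨w / y, by field_simp⟩
  obtain ⟨v, rfl⟩ : ∃ v, s = y * v := ⟨s / y, by field_simp⟩
  have hu : 0 ≤ u := by
    by_contra hc
    push Not at hc
    nlinarith
  have h1 : 1 - p^2 ≤ u := le_of_mul_le_mul_left h hy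
  have hv : 2 * u ≤ v ∨ 4 * u^2 ≤ v := by
    rcases hs with hs | hs
    · left
      have : y * (2 * u) ≤ y * v := by linarith
      exact le_of_mul_le_mul_left this hy
    · right
      have : y^2 * (4 * u^2) ≤ y^2 * v := by nlinarith
      exact le_of_mul_le_mul_left this (by positivity)
  have key : 1 ≤ (1 + u/2 + v) * p := by
    rcases le_or_gt u (1/2) with hu2 | hu2
    · have hv2 : u^2 ≤ v := by
        rcases hv with hv | hv <;> nlinarith
      have h2 : 1 ≤ (1 + u/2 + u^2)^2 * p^2 := by
        have h3 : (1 + u/2 + u^2)^2 * (1 - u) ≤ (1 + u/2 + u^2)^2 * p^2 := by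
          apply mul_le_mul_of_nonneg_left _ (by positivity)
          linarith
        have h4 : u^3 ≤ 1/8 := by
          have := pow_le_pow_left₀ hu hu2 3
          norm_num at this ⊢; linarith
        have h5 : 1 ≤ (1 + u/2 + u^2)^2 * (1 - u) := by
          have : (1 + u/2 + u^2)^2 * (1 - u) = 1 + u^2 * (5/4 * (1 - u) - u^3) := by ring
          rw [this]
          have : 0 ≤ u^2 * (5/4 * (1 - u) - u^3) := by
            apply mul_nonneg (by positivity); linarith
          linarith
        linarith
      have h6 : 1 ≤ (1 + u/2 + u^2) * p := by
        rw [← mul_pow] at h2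
        exact (one_le_sq_iff₀ (by positivity)).1 h2
      nlinarith
    · have : 1 ≤ v := by
        rcases hv with hv | hv <;> nlinarith
      nlinarith
  have : (y + y * u / 2 + y * v) * p = y * ((1 + u/2 + v) * p) := by ring
  rw [this]
  nlinarith

/-- abstract comparison on a half interval -/
lemma aux_half (k : ℕ) (b M : ℝ) (hb : 0 < b) (hM : 0 < M) (g g1 : ℝ → ℝ)
    (hg : ∀ t, HasDerivAt g (g1 t) t)
    (hg0 : g 0 = 0) (hgb : g b = M)
    (hpos : ∀ t ∈ Ioo 0 b, 0 < g t) (hlt : ∀ t ∈ Ioo 0 b, g t < M)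
    (φ : ℝ → ℝ) (hφ : Continuous φ)
    (H : ∀ t ∈ Ioo 0 b, g t ^ (k+1) ≤
      φ (arcsin (g t / M)) * (g1 t / M / √(1 - (g t / M)^2))) :
    ∫ t in (0:ℝ)..b, g t ^ (k+1) ≤ ∫ x in (0:ℝ)..(π/2), φ x := by
  have gc : Continuous g := continuous_iff_continuousAt.2 fun t => (hg t).continuousAt
  have gpc : Continuous fun t => g t ^ (k+1) := gc.pow _
  have dP : ∀ s, HasDerivAt (fun s => ∫ x in (0:ℝ)..s, φ x) (φ s) s := fun s =>
    intervalIntegral.integral_hasDerivAt_right (hφ.intervalIntegrable _ _)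
      (hφ.stronglyMeasurableAtFilter _ _) hφ.continuousAt
  have dG : ∀ s, HasDerivAt (fun s => ∫ x in (0:ℝ)..s, g x ^ (k+1)) (g s ^ (k+1)) s := fun s =>
    intervalIntegral.integral_hasDerivAt_right (gpc.intervalIntegrable _ _)
      (gpc.stronglyMeasurableAtFilter _ _) gpc.continuousAt
  have Pc : Continuous (fun s => ∫ x in (0:ℝ)..s, φ x) :=
    continuous_iff_continuousAt.2 fun t => (dP t).continuousAt
  have Gc : Continuous (fun s => ∫ x in (0:ℝ)..s, g x ^ (k+1)) :=
    continuous_iff_continuousAt.2 fun t => (dG t).continuousAt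
  have mono : MonotoneOn (fun t => (∫ x in (0:ℝ)..(arcsin (g t / M)), φ x)
      - ∫ x in (0:ℝ)..t, g x ^ (k+1)) (Icc 0 b) := by
    apply monotoneOn_of_hasDerivWithinAt_nonneg (convex_Icc 0 b)
      (f' := fun t => φ (arcsin (g t / M)) * (g1 t / M / √(1 - (g t / M)^2)) - g t ^ (k+1))
    · exact ((Pc.comp (continuous_arcsin.comp (gc.div_const M))).sub Gc).continuousOn
    · intro t ht
      rw [interior_Icc] at ht
      apply HasDerivAt.hasDerivWithinAt
      have hx1 : g t / M < 1 := by rw [div_lt_one hM]; exact hlt t ht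
      have hx0 : 0 < g t / M := div_pos (hpos t ht) hM
      have d1 : HasDerivAt (fun t => arcsin (g t / M)) (1 / √(1 - (g t / M)^2) * (g1 t / M)) t :=
        HasDerivAt.comp t (hasDerivAt_arcsin (by linarith) (by linarith)) ((hg t).div_const M)
      have d2 := HasDerivAt.comp t (dP (arcsin (g t / M))) d1
      have d3 := d2.sub (dG t)
      exact d3.congr_deriv (by ring)
    · intro t ht
      rw [interior_Icc] at ht
      have := H t ht
      linarith
  have := mono (left_mem_Icc.2 hb.le) (right_mem_Icc.2 hb.le) hb.le
  simp [hg0, hgb, hM.ne'] at this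
  exact this

lemma aux_H (k : ℕ) :
    ∫ x in (0:ℝ)..(π/2), (sin x * (∑ i ∈ Finset.range k, sin x ^ i) / (1 + sin x))
     = (k+1) * (∫ x in (0:ℝ)..(π/2), sin x ^ (k+1)) - 1 := by
  have hs : ∀ x ∈ Icc (0:ℝ) (π/2), 1 + sin x ≠ 0 := by
    intro x hx
    have := sin_nonneg_of_nonneg_of_le_pi hx.1 (by linarith [hx.2, pi_pos])
    linarith
  have hc1 : ContinuousOn (fun x => sin x * (∑ i ∈ Finset.range k, sin x ^ i) / (1 + sin x))
      (Icc 0 (π/2)) := by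
    apply ContinuousOn.div _ _ hs
    · fun_prop
    · fun_prop
  have hle : (0:ℝ) ≤ π/2 := by positivity
  have i1 : IntervalIntegrable (fun x => sin x * (∑ i ∈ Finset.range k, sin x ^ i) / (1 + sin x))
      MeasureTheory.volume 0 (π/2) := by
    apply ContinuousOn.intervalIntegrable
    rwa [uIcc_of_le hle]
  have i2 : IntervalIntegrable (fun x => ((k:ℝ)+1) * sin x ^ (k+1))
      MeasureTheory.volume 0 (π/2) := by
    apply Continuous.intervalIntegrable; fun_prop
  have key := integral_eq_sub_of_hasDerivAt_of_le hle
    (f := fun x => - (cos x * (∑ i ∈ Finset.range (k+2), sin x ^ i) / (1 + sin x)))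
    (f' := fun x => ((k:ℝ)+1) * sin x ^ (k+1)
      - sin x * (∑ i ∈ Finset.range k, sin x ^ i) / (1 + sin x)) ?_ ?_ (i2.sub i1)
  · rw [intervalIntegral.integral_sub i2 i1, intervalIntegral.integral_const_mul] at key
    have : ∑ i ∈ Finset.range (k+2), (0:ℝ)^i = 1 := by
      rw [Finset.sum_range_succ']; simp
    simp only [cos_pi_div_two, cos_zero, sin_zero, this] at key
    norm_num at key
    linarith
  · apply ContinuousOn.neg
    apply ContinuousOn.div _ _ hs
    · fun_prop
    · fun_prop
  · intro x hx
    have hcos : 0 < cos x := cos_pos_of_mem_Ioo ⟨by linarith [hx.1, pi_pos], hx.2⟩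
    have hsc := sin_sq_add_cos_sq x
    have eqn : ∀ y ∈ Ioo (0:ℝ) (π/2), (sin y ^ (k+2) - 1) / cos y =
        - (cos y * (∑ i ∈ Finset.range (k+2), sin y ^ i) / (1 + sin y)) := by
      intro y hy
      have hcos : 0 < cos y := cos_pos_of_mem_Ioo ⟨by linarith [hy.1, pi_pos], hy.2⟩
      have hsc := sin_sq_add_cos_sq y
      have h1 := hs y ⟨hy.1.le, hy.2.le⟩
      have hg := geom_sum_mul (sin y) (k+2)
      rw [← hg]
      field_simp
      linear_combination (∑ i ∈ Finset.range (k+2), sin y ^ i) * hsc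
    have d : HasDerivAt (fun y => (sin y ^ (k+2) - 1) / cos y)
      (((((k+2 : ℕ) : ℝ) * sin x ^ (k+2-1) * cos x) * cos x - (sin x ^ (k+2) - 1) * (- sin x))
        / cos x ^ 2) x :=
      (((hasDerivAt_sin x).pow (k+2)).sub_const 1).div (hasDerivAt_cos x) hcos.ne'
    have d' := d.congr_of_eventuallyEq (f₁ := fun y => - (cos y * (∑ i ∈ Finset.range (k+2), sin y ^ i) / (1 + sin y))) (by
      filter_upwards [Ioo_mem_nhds hx.1 hx.2] with y hy
      exact (eqn y hy).symm)
    convert d' using 1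
    have h1 := hs x ⟨hx.1.le, hx.2.le⟩
    have hg := geom_sum_mul (sin x) k
    have h2 : sin x * (∑ i ∈ Finset.range k, sin x ^ i) / (1 + sin x)
        = sin x * (1 - sin x ^ k) / cos x ^ 2 := by
      rw [div_eq_div_iff h1 (by positivity)]
      linear_combination (sin x * (∑ i ∈ Finset.range k, sin x ^ i)) * hsc
        - sin x * (1 + sin x) * hg
    rw [h2]
    have : k + 2 - 1 = k + 1 := rfl
    rw [this]
    field_simp
    push_cast
    ring_nf
    have hc : cos x ^ 2 = 1 - sin x ^ 2 := by linarith
    rw [hc]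
    ring

lemma aux_fin (j ν η A : ℝ) (hην : η = 2 * ν + ν^2) (hν0 : 0 ≤ ν)
    (hν4 : ν * (3 * (j+2)) ≤ 1/32) (hA0 : 0 ≤ A) (hA1 : A ≤ 2) :
    A + η / 2 * ((j + 1 + 1) * A - 1) + π / 2 * (η / 8) ≤ (1 + (j + 2) * ν) * A := by
  have hη0 : 0 ≤ η := by rw [hην]; positivity
  have b1 : π / 2 * (η / 8) ≤ η / 4 := by nlinarith [pi_le_four]
  have b2 : (j+2) * ν^2 * A / 2 ≤ η / 4 := by
    have h1 : (j+2) * ν * A ≤ 1 := by nlinarith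
    have h2 : ν * ((j+2) * ν * A) ≤ ν * 1 := mul_le_mul_of_nonneg_left h1 hν0
    nlinarith
  have e : η / 2 * ((j + 1 + 1) * A - 1) = (j+2) * ν * A + (j+2) * ν^2 * A / 2 - η / 2 := by
    rw [hην]; ring
  linarith

set_option maxHeartbeats 1000000 in
lemma aux_main (j : ℕ) (c : ℝ) (hc : c ∈ Ioo (0:ℝ) 1) (hc2 : 1/2 ≤ c)
    (hcν : (1 / c - 1) * (3 * (j+2)) ≤ (1/(16*(j+1)))^(j+2) / (32 * (j+1)^2))
    (b : ℝ) (hb : 0 < b) (g g1 g2 : ℝ → ℝ)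
    (hg : ∀ t, HasDerivAt g (g1 t) t) (hg1 : ∀ t, HasDerivAt g1 (g2 t) t)
    (hg0 : g 0 = 0) (hg1b : g1 b = 0)
    (hpos : ∀ t ∈ Ioo 0 b, 0 < g t) 
    (h1 : ∀ t ∈ Ioo 0 b, g2 t ≤ - (c^2 * g t))
    (h3 : ∀ t ∈ Ioo 0 b, ((j:ℝ)+3) * g t ^ 2 ≤ -2 * g t * g2 t + (j+1) * (1 - g1 t ^ 2)) :
    ∫ t in (0:ℝ)..b, g t ^ (j+2) ≤ ∫ x in (0:ℝ)..(π/2), sin x ^ (j+2) := by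
  obtain ⟨hc0, hc1⟩ := hc
  have gc : Continuous g := continuous_iff_continuousAt.2 fun t => (hg t).continuousAt
  have g1c : Continuous g1 := continuous_iff_continuousAt.2 fun t => (hg1 t).continuousAt
  -- g1 positive
  have hanti : StrictAntiOn g1 (Icc 0 b) := by
    apply strictAntiOn_of_hasDerivWithinAt_neg (convex_Icc 0 b) g1c.continuousOn (f' := g2)
    · intro t ht; exact (hg1 t).hasDerivWithinAt
    · intro t ht
      rw [interior_Icc] at ht
      have := h1 t ht
      have := mul_pos (pow_pos hc0 2) (hpos t ht)
      linarith
  have g1pos : ∀ t ∈ Ioo 0 b, 0 < g1 t := by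
    intro t ht
    have := hanti ⟨ht.1.le, ht.2.le⟩ (right_mem_Icc.2 hb.le) ht.2
    linarith
  have hmono : StrictMonoOn g (Icc 0 b) := by
    apply strictMonoOn_of_hasDerivWithinAt_pos (convex_Icc 0 b) gc.continuousOn (f' := g1)
    · intro t ht; exact (hg t).hasDerivWithinAt
    · intro t ht
      rw [interior_Icc] at ht
      exact g1pos t ht
  obtain ⟨M, hM⟩ : ∃ M, M = g b := ⟨_, rfl⟩
  have hM0 : 0 < M := by
    have := hmono (left_mem_Icc.2 hb.le) (right_mem_Icc.2 hb.le) hb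
    linarith
  have hlt : ∀ t ∈ Ioo 0 b, g t < M := by
    intro t ht
    have := hmono ⟨ht.1.le, ht.2.le⟩ (right_mem_Icc.2 hb.le) ht.2
    linarith
  -- energies
  have hE1 : AntitoneOn (fun t => g1 t ^ 2 + c^2 * g t ^ 2) (Icc 0 b) := by
    apply antitoneOn_of_hasDerivWithinAt_nonpos (convex_Icc 0 b)
      (f' := fun t => 2 * g1 t * (g2 t + c^2 * g t))
    · fun_prop
    · intro t ht
      apply HasDerivAt.hasDerivWithinAt
      have := ((hg1 t).pow 2).add (((hg t).pow 2).const_mul (c^2))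
      exact this.congr_deriv (by norm_num; ring)
    · intro t ht
      rw [interior_Icc] at ht
      have a1 := g1pos t ht
      have a2 := h1 t ht
      apply mul_nonpos_of_nonneg_of_nonpos <;> linarith
  have hE2 : MonotoneOn (fun t => g t ^ (j+1) * (1 - g1 t ^ 2 - g t ^ 2)) (Icc 0 b) := by
    apply monotoneOn_of_hasDerivWithinAt_nonneg (convex_Icc 0 b)
      (f' := fun t => g1 t * g t ^ j * (((j:ℝ)+1) * (1 - g1 t ^ 2) - 2 * g t * g2 t - (j+3) * g t ^ 2))
    · fun_prop
    · intro t ht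
      apply HasDerivAt.hasDerivWithinAt
      have := ((hg t).pow (j+1)).mul ((((hg1 t).pow 2).const_sub 1).sub ((hg t).pow 2))
      refine this.congr_deriv ?_
      simp only [Pi.pow_apply, Pi.sub_apply, Nat.add_sub_cancel]
      push_cast
      ring
    · intro t ht
      rw [interior_Icc] at ht
      have a1 := g1pos t ht
      have a2 := h3 t ht
      have a3 := hpos t ht
      apply mul_nonneg (by positivity)
      linarith
  have e1 : ∀ t ∈ Ioo 0 b, c^2 * (M^2 - g t ^2) ≤ g1 t ^ 2 := by
    intro t ht
    have := hE1 ⟨ht.1.le, ht.2.le⟩ (right_mem_Icc.2 hb.le) ht.2.le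
    simp only [hg1b, ← hM] at this
    linarith
  have e2 : ∀ t ∈ Ioo 0 b, g t ^ (j+1) * (1 - g1 t ^ 2 - g t ^ 2) ≤ M^(j+1) * (1 - M^2) := by
    intro t ht
    have := hE2 ⟨ht.1.le, ht.2.le⟩ (right_mem_Icc.2 hb.le) ht.2.le
    simp only [hg1b, ← hM] at this
    linarith
  have hM1 : M ≤ 1 := by
    have := hE2 (left_mem_Icc.2 hb.le) (right_mem_Icc.2 hb.le) hb.le
    simp only [hg1b, ← hM, hg0] at this
    have h0 : 0 ≤ M^(j+1) * (1 - M^2) := by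
      simpa using this
    have := nonneg_of_mul_nonneg_right h0 (by positivity)
    nlinarith
  -- normalized quantities
  have norm : ∀ t ∈ Ioo 0 b, ∃ x p : ℝ, 0 < x ∧ x < 1 ∧ g t / M = x ∧ g t = M * x ∧
      g1 t / M / √(1 - (g t / M)^2) = p ∧ c ≤ p ∧
      x^(j+1) * (1 - x^2) * (1 - p^2) ≤ (1/M^2 - 1) * (1 - x^(j+1)) := by
    intro t ht
    have a1 := g1pos t ht
    have a3 := hpos t ht
    have a4 := hlt t ht
    obtain ⟨x, hx⟩ : ∃ x, g t / M = x := ⟨_, rfl⟩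
    have hgx : g t = M * x := by rw [← hx]; field_simp
    have hx0 : 0 < x := by rw [← hx]; positivity
    have hx1 : x < 1 := by rw [← hx, div_lt_one hM0]; exact a4
    have hq : 0 < 1 - x^2 := by nlinarith
    have hr : 0 < √(1 - x^2) := sqrt_pos.2 hq
    have hr2 : √(1 - x^2)^2 = 1 - x^2 := sq_sqrt hq.le
    obtain ⟨p, hp⟩ : ∃ p, g1 t / M / √(1 - (g t / M)^2) = p := ⟨_, rfl⟩
    have hg1p : g1 t = M * p * √(1 - x^2) := by rw [← hp, hx]; field_simp
    have hp0 : 0 < p := by rw [← hp, hx]; positivity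
    have hsq : g1 t ^ 2 = M^2 * p^2 * (1 - x^2) := by rw [hg1p, mul_pow, mul_pow, hr2]
    refine ⟨x, p, hx0, hx1, hx, hgx, hp, ?_, ?_⟩
    · have := e1 t ht
      rw [hsq, hgx] at this
      have h4 : (M^2 * (1 - x^2)) * c^2 ≤ (M^2 * (1 - x^2)) * p^2 := by linarith
      have h5 := le_of_mul_le_mul_left h4 (by positivity)
      exact (sq_le_sq₀ hc0.le hp0.le).1 h5
    · have := e2 t ht
      rw [hsq, hgx, mul_pow, mul_assoc] at this
      have h5 := le_of_mul_le_mul_left this (by positivity)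
      have h6 : (1/M^2 - 1) * (1 - x^(j+1)) = (1 - M^2) * (1 - x^(j+1)) / M^2 := by
        field_simp
      rw [h6, le_div_iff₀ (by positivity)]
      linarith
  rcases le_or_gt M c with hMc | hMc
  · apply aux_half (j+1) b M hb hM0 g g1 hg hg0 hM.symm hpos hlt (fun x => sin x ^ (j+2))
      (by fun_prop)
    intro t ht
    obtain ⟨x, p, hx0, hx1, hx, hgx, hp, hcp, -⟩ := norm t ht
    rw [hp, hx, hgx]
    rw [sin_arcsin (by linarith) (by linarith), mul_pow, mul_comm]
    apply mul_le_mul_of_nonneg_left _ (by positivity)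
    calc M^(j+1+1) ≤ M^1 := pow_le_pow_of_le_one hM0.le hM1 (by omega)
      _ ≤ p := by linarith
  · obtain ⟨ν, hν⟩ : ∃ ν, ν = 1 / M - 1 := ⟨_, rfl⟩
    have hMν : M * (1 + ν) = 1 := by rw [hν]; field_simp; ring
    have hν0 : 0 ≤ ν := by
      rw [hν, sub_nonneg, le_div_iff₀ hM0]; linarith
    have hνc : ν ≤ 1 / c - 1 := by
      rw [hν]
      have := one_div_le_one_div_of_le hc0 hMc.le
      linarith
    obtain ⟨η, hη⟩ : ∃ η, η = 1/M^2 - 1 := ⟨_, rfl⟩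
    have hην : η = 2 * ν + ν^2 := by rw [hη, hν]; field_simp; ring
    have hη0 : 0 ≤ η := by rw [hην]; positivity
    have hJ : (1:ℝ) ≤ j + 1 := by linarith [(Nat.cast_nonneg j : (0:ℝ) ≤ j)]
    have hR1 : (1/(16*((j:ℝ)+1)))^(j+2) ≤ 1 := by
      apply pow_le_one₀ (by positivity)
      rw [div_le_one (by positivity)]
      linarith
    have hν3 : ν * (3 * (j+2)) ≤ (1/(16*(j+1)))^(j+2) / (32 * (j+1)^2) := by
      refine le_trans ?_ hcν
      exact mul_le_mul_of_nonneg_right hνc (by positivity)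
    have hν4 : ν * (3 * (j+2)) ≤ 1/32 := by
      refine hν3.trans ?_
      rw [div_le_div_iff₀ (by positivity) (by norm_num)]
      nlinarith
    have hν1 : ν ≤ 1 := by nlinarith
    have hη3 : η ≤ (1/(16*(j+1)))^(j+2) / (32 * (j+1)^2) := by
      refine le_trans ?_ hν3
      rw [hην]; nlinarith
    have hη4 : 32 * (j+1)^2 * η ≤ (1/(16*((j:ℝ)+1)))^(j+2) := by
      rw [le_div_iff₀ (by positivity)] at hη3
      linarith
    have hhalf := aux_half (j+1) b M hb hM0 g g1 hg hg0 hM.symm hpos hlt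
      (fun x => M^(j+2) * (sin x ^ (j+2)
        + η / 2 * (|sin x| * (∑ i ∈ Finset.range (j+1), sin x ^ i) / (1 + |sin x|)) + η / 8))
      (by
        have : ∀ x, 1 + |sin x| ≠ 0 := fun x => by positivity
        fun_prop (disch := assumption)) ?_
    · refine hhalf.trans ?_
      have hle : (0:ℝ) ≤ π/2 := by positivity
      have hcongr : ∫ x in (0:ℝ)..(π/2), (M^(j+2) * (sin x ^ (j+2)
        + η / 2 * (|sin x| * (∑ i ∈ Finset.range (j+1), sin x ^ i) / (1 + |sin x|)) + η / 8))
        = ∫ x in (0:ℝ)..(π/2), (M^(j+2) * (sin x ^ (j+2)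
        + η / 2 * (sin x * (∑ i ∈ Finset.range (j+1), sin x ^ i) / (1 + sin x)) + η / 8)) := by
        apply intervalIntegral.integral_congr
        intro x hx
        rw [uIcc_of_le hle] at hx
        have := sin_nonneg_of_nonneg_of_le_pi hx.1 (by linarith [hx.2, pi_pos])
        simp only [abs_of_nonneg this]
      have i1 : IntervalIntegrable (fun x => sin x ^ (j+2)) MeasureTheory.volume 0 (π/2) := by
        apply Continuous.intervalIntegrable; fun_prop
      have i2 : IntervalIntegrable (fun x => η / 2 * (sin x * (∑ i ∈ Finset.range (j+1), sin x ^ i) / (1 + sin x))) MeasureTheory.volume 0 (π/2) := by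
        apply ContinuousOn.intervalIntegrable
        rw [uIcc_of_le hle]
        apply ContinuousOn.mul continuousOn_const
        apply ContinuousOn.div
        · fun_prop
        · fun_prop
        · intro x hx
          have := sin_nonneg_of_nonneg_of_le_pi hx.1 (by linarith [hx.2, pi_pos])
          linarith
      rw [hcongr, intervalIntegral.integral_const_mul,
        intervalIntegral.integral_add (i1.add i2) (by simp),
        intervalIntegral.integral_add i1 i2, intervalIntegral.integral_const_mul,
        aux_H (j+1), intervalIntegral.integral_const]
      have hA0 : 0 ≤ ∫ x in (0:ℝ)..(π/2), sin x ^ (j+2) := by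
        apply intervalIntegral.integral_nonneg hle
        intro x hx
        have := sin_nonneg_of_nonneg_of_le_pi hx.1 (by linarith [hx.2, pi_pos])
        positivity
      have hA1 : ∫ x in (0:ℝ)..(π/2), sin x ^ (j+2) ≤ 2 := by
        have : ∫ x in (0:ℝ)..(π/2), sin x ^ (j+2) ≤ ∫ x in (0:ℝ)..(π/2), (1:ℝ) := by
          apply intervalIntegral.integral_mono_on hle i1 (by simp)
          intro x hx
          have := sin_nonneg_of_nonneg_of_le_pi hx.1 (by linarith [hx.2, pi_pos])
          exact pow_le_one₀ this (sin_le_one x)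
        rw [intervalIntegral.integral_const] at this
        simp at this
        linarith [pi_le_four]
      have e : j + 1 + 1 = j + 2 := rfl
      rw [e]
      generalize (∫ x in (0:ℝ)..(π/2), sin x ^ (j+2)) = A at hA0 hA1 ⊢
      have hbern : 1 + ((j+2 : ℕ):ℝ) * ν ≤ (1 + ν)^(j+2) :=
        one_add_mul_le_pow (by linarith) _
      push_cast at hbern
      have hprod : M^(j+2) * (1+ν)^(j+2) = 1 := by rw [← mul_pow, hMν, one_pow]
      calc _ ≤ M^(j+2) * ((1+ν)^(j+2) * A) := by
            apply mul_le_mul_of_nonneg_left _ (by positivity)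
            refine le_trans ?_ (mul_le_mul_of_nonneg_right hbern hA0)
            push_cast
            rw [smul_eq_mul, sub_zero]
            exact aux_fin j ν η A hην hν0 hν4 hA0 hA1
        _ = A := by rw [← mul_assoc, hprod, one_mul]
    · intro t ht
      obtain ⟨x, p, hx0, hx1, hx, hgx, hp, hcp, hxp⟩ := norm t ht
      rw [hp, hx, hgx]
      rw [sin_arcsin (by linarith) (by linarith), mul_pow, mul_assoc, abs_of_pos hx0]
      apply mul_le_mul_of_nonneg_left _ (by positivity)
      obtain ⟨S, hS⟩ : ∃ S, S = ∑ i ∈ Finset.range (j+1), x ^ i := ⟨_, rfl⟩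
      rw [← hS]
      have hS0 : 0 ≤ S := by
        rw [hS]; exact Finset.sum_nonneg fun i _ => pow_nonneg hx0.le i
      have hS1 : S ≤ j + 1 := by
        have : S ≤ ∑ i ∈ Finset.range (j+1), (1:ℝ) := by
          rw [hS]
          exact Finset.sum_le_sum fun i _ => pow_le_one₀ hx0.le hx1.le
        simpa using this
      have hgeo : S * (1 - x) = 1 - x^(j+1) := by
        rw [hS]; linear_combination - geom_sum_mul x (j+1)
      obtain ⟨h, hh⟩ : ∃ h, h = x * S / (1 + x) := ⟨_, rfl⟩
      rw [← hh]
      have hh0 : 0 ≤ h := by rw [hh]; positivity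
      have hhx : h ≤ (j+1) * x := by
        rw [hh, div_le_iff₀ (by positivity)]
        nlinarith [mul_nonneg hx0.le hx0.le, mul_nonneg (by positivity : (0:ℝ) ≤ j+1) (mul_nonneg hx0.le hx0.le)]
      have hy : x^(j+2) * (1 - p^2) ≤ η * h := by
        rw [← hη, ← hgeo] at hxp
        have : (1 - x) * (x^(j+1) * (1 + x) * (1 - p^2)) ≤ (1 - x) * (η * S) := by linarith
        have := le_of_mul_le_mul_left this (by linarith)
        have e : η * h = (η * S) * x / (1 + x) := by rw [hh]; ring
        rw [e, le_div_iff₀ (by positivity)]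
        have := mul_le_mul_of_nonneg_right this hx0.le
        rw [pow_succ x (j+1)]
        linarith
      have := aux_pt (x^(j+2)) (η * h) p (η/8) (by positivity) (by positivity) (by linarith) hy ?_
      · rw [show η / 2 * h = η * h / 2 by ring]; exact this
      · rcases le_or_gt x (1/(16*((j:ℝ)+1))) with hr | hr
        · left
          rw [le_div_iff₀ (by positivity)] at hr
          have : 2 * h ≤ 1/8 := by linarith
          nlinarith
        · right
          have hy2 : (1/(16*((j:ℝ)+1)))^(j+2) ≤ x^(j+2) :=
            pow_le_pow_left₀ (by positivity) hr.le _
          have h2 : h ≤ j + 1 := by nlinarith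
          have h3 : h^2 ≤ (j+1)^2 := pow_le_pow_left₀ hh0 h2 2
          have h4 : 32 * h^2 * η ≤ x^(j+2) := by
            have := mul_le_mul_of_nonneg_left h3 hη0
            linarith
          have := mul_le_mul_of_nonneg_left h4 hη0
          linarith

theorem stmt_0 (n : ℕ) (hn : 3 ≤ n) :
    ∃ ε : ℝ, ε ∈ Set.Ioo (0:ℝ) 1 ∧
      ∀ (a : ℝ), 0 < a →
      ∀ f : ℝ → ℝ, ContDiff ℝ (⊤ : ℕ∞) f →
        f 0 = 0 → f a = 0 →
        (∀ t ∈ Set.Ioo 0 a, 0 < f t) →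
        (∀ t ∈ Set.Ioo 0 a, -(deriv (deriv f) t) / f t ≥ ε) →
        (∀ t ∈ Set.Ioo 0 a,
          (n - 2 : ℝ) / f t ^ 2 - deriv (deriv f) t / f t
            - (n - 2 : ℝ) * (deriv f t) ^ 2 / f t ^ 2 ≥ ((n : ℝ) - 1) * ε) →
        (∀ t ∈ Set.Ioo 0 a,
          -(2 * deriv (deriv f) t) / f t + (n - 2 : ℝ) / f t ^ 2
            - (n - 2 : ℝ) * (deriv f t) ^ 2 / f t ^ 2 ≥ (n : ℝ)) →
        ∫ t in (0:ℝ)..a, f t ^ (n - 1) ≤ ∫ t in (0:ℝ)..π, Real.sin t ^ (n - 1) := by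
  obtain ⟨j, rfl⟩ : ∃ j, n = j + 3 := ⟨n - 3, by omega⟩
  obtain ⟨d, hd⟩ : ∃ d : ℝ, d = (1/(16*((j:ℝ)+1)))^(j+2) / (32 * (j+1)^2) / (3 * (j+2)) :=
    ⟨_, rfl⟩
  have hd0 : 0 < d := by rw [hd]; positivity
  have hJ : (1:ℝ) ≤ j + 1 := by linarith [(Nat.cast_nonneg j : (0:ℝ) ≤ j)]
  have hd1 : d ≤ 1 := by
    have hR1 : (1/(16*((j:ℝ)+1)))^(j+2) ≤ 1 := by
      apply pow_le_one₀ (by positivity)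
      rw [div_le_one (by positivity)]
      linarith
    rw [hd, div_div, div_le_one (by positivity)]
    have : (1:ℝ) ≤ (j+1)^2 := one_le_pow₀ hJ
    nlinarith
  obtain ⟨c, hcd⟩ : ∃ c : ℝ, c = 1 / (1 + d) := ⟨_, rfl⟩
  have hc0 : 0 < c := by rw [hcd]; positivity
  have hc1 : c < 1 := by rw [hcd, div_lt_one (by positivity)]; linarith
  have hc2 : 1/2 ≤ c := by
    rw [hcd]; exact one_div_le_one_div_of_le (by positivity) (by linarith)
  have hcν : (1 / c - 1) * (3 * (j+2)) ≤ (1/(16*((j:ℝ)+1)))^(j+2) / (32 * (j+1)^2) := by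
    have : 1 / c - 1 = d := by rw [hcd, one_div_one_div]; ring
    rw [this, hd]
    rw [div_mul_cancel₀ _ (by positivity)]
  refine ⟨c^2, ⟨by positivity, by nlinarith⟩, ?_⟩
  intro a ha f hf hf0 hfa hpos h1 _ h3
  have hd1f : ∀ t, HasDerivAt f (deriv f t) t := fun t =>
    (hf.differentiable (by simp) t).hasDerivAt
  have hf' : ContDiff ℝ 1 (deriv f) := by
    have : ContDiff ℝ (1+1) f := (contDiff_infty.1 hf 2)
    exact ((contDiff_succ_iff_deriv).1 this).2.2
  have hd2f : ∀ t, HasDerivAt (deriv f) (deriv (deriv f) t) t := fun t =>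
    (hf'.differentiable (by simp) t).hasDerivAt
  have H1 : ∀ t ∈ Ioo 0 a, deriv (deriv f) t ≤ - (c^2 * f t) := by
    intro t ht
    have := h1 t ht
    rw [ge_iff_le, le_div_iff₀ (hpos t ht)] at this
    linarith
  have H3 : ∀ t ∈ Ioo 0 a, ((j:ℝ)+3) * f t ^ 2 ≤
      -2 * f t * deriv (deriv f) t + (j+1) * (1 - deriv f t ^ 2) := by
    intro t ht
    have := h3 t ht
    have hp := hpos t ht
    have e : -(2 * deriv (deriv f) t) / f t + (((j+3:ℕ):ℝ) - 2) / f t ^ 2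
            - (((j+3:ℕ):ℝ) - 2) * (deriv f t) ^ 2 / f t ^ 2
        = (-2 * f t * deriv (deriv f) t + (j+1) * (1 - deriv f t ^ 2)) / f t ^ 2 := by
      push_cast
      field_simp
      ring
    rw [e, ge_iff_le, le_div_iff₀ (by positivity)] at this
    push_cast at this
    exact this
  obtain ⟨b, hb, hb1⟩ : ∃ b ∈ Ioo 0 a, deriv f b = 0 :=
    exists_deriv_eq_zero ha hf.continuous.continuousOn (by rw [hf0, hfa])
  have L := aux_main j c ⟨hc0, hc1⟩ hc2 hcν b hb.1 f (deriv f) (deriv (deriv f)) hd1f hd2f hf0 hb1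
    (fun t ht => hpos t ⟨ht.1, ht.2.trans hb.2⟩)
    (fun t ht => H1 t ⟨ht.1, ht.2.trans hb.2⟩)
    (fun t ht => H3 t ⟨ht.1, ht.2.trans hb.2⟩)
  have mem : ∀ t ∈ Ioo 0 (a - b), a - t ∈ Ioo 0 a := fun t ht =>
    ⟨by linarith [ht.2, hb.1], by linarith [ht.1]⟩
  have dsub : ∀ t, HasDerivAt (fun t : ℝ => a - t) (-1) t := fun t => by
    simpa using (hasDerivAt_id t).const_sub a
  have R := aux_main j c ⟨hc0, hc1⟩ hc2 hcν (a - b) (by linarith [hb.2]) (fun t => f (a - t))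
    (fun t => - deriv f (a - t)) (fun t => deriv (deriv f) (a - t))
    (fun t => by
      have := HasDerivAt.comp t (hd1f (a - t)) (dsub t)
      exact this.congr_deriv (by ring))
    (fun t => by
      have := (HasDerivAt.comp t (hd2f (a - t)) (dsub t)).neg
      exact this.congr_deriv (by ring))
    (by simp [hfa]) (by simp [hb1])
    (fun t ht => hpos _ (mem t ht))
    (fun t ht => H1 _ (mem t ht))
    (fun t ht => by
      have := H3 _ (mem t ht)
      simpa using this)
  have R2 : ∫ t in (0:ℝ)..(a-b), f (a - t) ^ (j+2) = ∫ t in b..a, f t ^ (j+2) := by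
    rw [intervalIntegral.integral_comp_sub_left (fun t => f t ^ (j+2)) a]
    simp
  have S2 : ∫ t in (π/2)..π, sin t ^ (j+2) = ∫ t in (0:ℝ)..(π/2), sin t ^ (j+2) := by
    have := intervalIntegral.integral_comp_sub_left (a := 0) (b := π/2) (fun t => sin t ^ (j+2)) π
    simp only [sin_pi_sub, sub_zero] at this
    rw [this]
    congr 1
    ring
  have hfc : Continuous fun t => f t ^ (j+2) := hf.continuous.pow _
  have hsc : Continuous fun t => sin t ^ (j+2) := continuous_sin.pow _
  have e : j + 3 - 1 = j + 2 := rfl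
  rw [e, ← intervalIntegral.integral_add_adjacent_intervals (hfc.intervalIntegrable 0 b)
    (hfc.intervalIntegrable b a),
    ← intervalIntegral.integral_add_adjacent_intervals (hsc.intervalIntegrable 0 (π/2))
    (hsc.intervalIntegrable (π/2) π), S2, ← R2]
  exact add_le_add L R
end

section
/- For every real number x ≥ 1/2, one has √(x - 1/2) · Γ(x)/Γ(x + 1/2) < √(x + 1/2) · Γ(x+1)/Γ(x + 3/2), where Γ denotes the Gamma function (at x = 1/2 the left-hand side is interpreted as 0). -/
open Real

theorem stmt_1 (x : ℝ) (hx : 1/2 ≤ x) :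
    Real.sqrt (x - 1/2) * (Real.Gamma x / Real.Gamma (x + 1/2)) <
      Real.sqrt (x + 1/2) * (Real.Gamma (x + 1) / Real.Gamma (x + 3/2)) := by
  have hg := Real.Gamma_pos_of_pos (show 0 < x by linarith)
  have hh := Real.Gamma_pos_of_pos (show 0 < x + 1/2 by linarith)
  have e1 : Real.Gamma (x + 1) = x * Real.Gamma x := Real.Gamma_add_one (by linarith)
  have e2 : Real.Gamma (x + 3/2) = (x + 1/2) * Real.Gamma (x + 1/2) := by
    rw [← Real.Gamma_add_one (by linarith)]
    congr 1
    ring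
  have hs := Real.sq_sqrt (show 0 ≤ x - 1/2 by linarith)
  have ht := Real.sq_sqrt (show 0 ≤ x + 1/2 by linarith)
  have htp := Real.sqrt_pos.2 (show 0 < x + 1/2 by linarith)
  have key : Real.sqrt (x - 1/2) * Real.sqrt (x + 1/2) < x := by
    apply lt_of_pow_lt_pow_left₀ 2 (by linarith)
    rw [mul_pow, hs, ht]
    nlinarith
  have key2 : Real.sqrt (x - 1/2) < Real.sqrt (x + 1/2) * (x / (x + 1/2)) := by
    rw [← mul_div_assoc, lt_div_iff₀ (by linarith)]
    calc Real.sqrt (x - 1/2) * (x + 1/2)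
        = Real.sqrt (x + 1/2) * (Real.sqrt (x - 1/2) * Real.sqrt (x + 1/2)) := by
          nth_rewrite 1 [← ht]
          ring
      _ < Real.sqrt (x + 1/2) * x := mul_lt_mul_of_pos_left key htp
  rw [e1, e2, mul_div_mul_comm, ← mul_assoc]
  exact mul_lt_mul_of_pos_right key2 (div_pos hg hh)
end

section
/- For every natural number k ≥ 2, ∫₀¹ t·(1 - t^{2k-1})/(1 - t²)^{3/2} dt = (√π/2) · Σ_{j=1}^{k-1} Γ(j + 1/2)/Γ(j+1) + (π - 2)/2. -/
open Real

lemma aux_sqrt_deriv (t : ℝ) (ht : t ∈ Set.Ioo (0:ℝ) 1) :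
    HasDerivAt (fun x : ℝ => Real.sqrt (1 - x ^ 2)) (-t / Real.sqrt (1 - t ^ 2)) t := by
  have h0 : 0 < 1 - t ^ 2 := by nlinarith [ht.1, ht.2]
  have h1 : HasDerivAt (fun x : ℝ => 1 - x ^ 2) (-(2 * t)) t := by
    have := (hasDerivAt_pow 2 t).const_sub 1
    simpa using this
  have h2 := h1.sqrt h0.ne'
  convert h2 using 1
  have : Real.sqrt (1 - t ^ 2) ≠ 0 := (Real.sqrt_pos.2 h0).ne'
  field_simp

lemma aux_G (j : ℕ) : ∃ G : ℝ → ℝ, Continuous G ∧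
    (∀ t ∈ Set.Ioo (0:ℝ) 1, HasDerivAt G (t ^ (2 * j) / Real.sqrt (1 - t ^ 2)) t) ∧
    G 1 - G 0 = (Real.sqrt π / 2) * (Real.Gamma (j + 1/2) / Real.Gamma (j + 1)) := by
  induction j with
  | zero =>
    refine ⟨Real.arcsin, Real.continuous_arcsin, ?_, ?_⟩
    · intro t ht
      have := Real.hasDerivAt_arcsin (x := t) (by linarith [ht.1]) (by linarith [ht.2])
      simpa using this
    · have h := Real.mul_self_sqrt Real.pi_pos.le
      have h2 : Real.Gamma ((0:ℕ) + 1/2) = Real.sqrt π := by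
        rw [← Real.Gamma_one_half_eq]; simp
      rw [h2]
      simp only [Real.arcsin_one, Real.arcsin_zero, Nat.cast_zero, zero_add, Real.Gamma_one]
      linarith
  | succ j ih =>
    obtain ⟨G, hc, hd, hv⟩ := ih
    refine ⟨fun t => ((2 * j + 1) * G t - t ^ (2 * j + 1) * Real.sqrt (1 - t ^ 2)) / (2 * j + 2),
      by fun_prop, ?_, ?_⟩
    · intro t ht
      have h0 : 0 < 1 - t ^ 2 := by nlinarith [ht.1, ht.2]
      have hs := Real.sqrt_pos.2 h0
      have hsq := Real.sq_sqrt h0.le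
      have h1 := ((((hd t ht).const_mul (2 * (j:ℝ) + 1)).sub
        ((hasDerivAt_pow (2 * j + 1) t).mul (aux_sqrt_deriv t ht))).div_const (2 * (j:ℝ) + 2))
      refine h1.congr_deriv ?_
      have hj : (2 * (j:ℝ) + 2) ≠ 0 := by positivity
      generalize Real.sqrt (1 - t ^ 2) = s at *
      push_cast
      rw [div_eq_div_iff hj hs.ne']
      field_simp
      rw [hsq]
      ring
    · have e1 : ((j + 1 : ℕ) : ℝ) + 1/2 = ((j:ℝ) + 1/2) + 1 := by push_cast; ring
      have e2 : ((j + 1 : ℕ) : ℝ) + 1 = ((j:ℝ) + 1) + 1 := by push_cast; ring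
      rw [e1, e2, Real.Gamma_add_one (by positivity), Real.Gamma_add_one (by positivity)]
      have hg : Real.Gamma ((j:ℝ) + 1) ≠ 0 := (Real.Gamma_pos_of_pos (by positivity)).ne'
      have hG : G 1 = G 0 + (Real.sqrt π / 2) * (Real.Gamma (j + 1/2) / Real.Gamma (j + 1)) := by
        linarith
      simp only [hG]
      generalize Real.Gamma ((j:ℝ) + 1) = a at *
      generalize Real.Gamma ((j:ℝ) + 1/2) = b at *
      simp
      field_simp
      ring

lemma aux_rpow (t : ℝ) (ht : t ∈ Set.Ioo (0:ℝ) 1) :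
    (1 - t ^ 2) ^ ((3:ℝ)/2) = (1 - t ^ 2) * Real.sqrt (1 - t ^ 2) := by
  have h0 : 0 < 1 - t ^ 2 := by nlinarith [ht.1, ht.2]
  rw [show (3:ℝ)/2 = 1 + 1/2 by norm_num, Real.rpow_add h0, Real.rpow_one, Real.sqrt_eq_rpow]

lemma aux_F (m : ℕ) : ∃ F : ℝ → ℝ, ContinuousOn F (Set.Icc 0 1) ∧
    (∀ t ∈ Set.Ioo (0:ℝ) 1,
      HasDerivAt F (t * (1 - t ^ (2 * m + 1)) / (1 - t ^ 2) ^ ((3:ℝ)/2)) t) ∧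
    F 1 - F 0 = (Real.sqrt π / 2) *
        ∑ j ∈ Finset.Icc 1 m, Real.Gamma (j + 1/2) / Real.Gamma (j + 1)
      + (π - 2) / 2 := by
  induction m with
  | zero =>
    refine ⟨fun t => Real.arcsin t + Real.sqrt (1 - t ^ 2) / (1 + t), ?_, ?_, ?_⟩
    · refine Real.continuous_arcsin.continuousOn.add (ContinuousOn.div (by fun_prop) (by fun_prop) ?_)
      intro x hx
      linarith [hx.1]
    · intro t ht
      rw [aux_rpow t ht]
      have h0 : 0 < 1 - t ^ 2 := by nlinarith [ht.1, ht.2]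
      have hs := Real.sqrt_pos.2 h0
      have hsq := Real.sq_sqrt h0.le
      have h1t : 1 + t ≠ 0 := by linarith [ht.1]
      have h2t : 1 - t ≠ 0 := by linarith [ht.2]
      have h1 := (Real.hasDerivAt_arcsin (x := t) (by linarith [ht.1]) (by linarith [ht.2])).add
        ((aux_sqrt_deriv t ht).div ((hasDerivAt_id t).const_add 1) h1t)
      refine h1.congr_deriv ?_
      simp only [id]
      generalize Real.sqrt (1 - t ^ 2) = s at *
      rw [show 1 - t ^ 2 = (1 - t) * (1 + t) by ring] at *
      field_simp
      rw [hsq]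
      ring
    · simp
      ring
  | succ m ih =>
    obtain ⟨F, hc, hd, hv⟩ := ih
    obtain ⟨G, gc, gd, gv⟩ := aux_G (m + 1)
    refine ⟨fun t => F t + G t, hc.add gc.continuousOn, ?_, ?_⟩
    · intro t ht
      refine ((hd t ht).add (gd t ht)).congr_deriv ?_
      rw [aux_rpow t ht]
      have h0 : 0 < 1 - t ^ 2 := by nlinarith [ht.1, ht.2]
      have hs := Real.sqrt_pos.2 h0
      generalize Real.sqrt (1 - t ^ 2) = s at *
      have := h0.ne'
      field_simp
      ring
    · rw [Finset.sum_Icc_succ_top (by omega), mul_add]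
      simp only
      linarith

theorem stmt_5 (k : ℕ) (hk : 2 ≤ k) :
    ∫ t in (0:ℝ)..1, t * (1 - t ^ (2 * k - 1)) / (1 - t ^ 2) ^ ((3:ℝ)/2) =
      (Real.sqrt π / 2) *
        ∑ j ∈ Finset.Icc 1 (k - 1), Real.Gamma (j + 1/2) / Real.Gamma (j + 1)
      + (π - 2) / 2 := by
  obtain ⟨m, rfl⟩ : ∃ m, k = m + 1 := ⟨k - 1, by omega⟩
  obtain ⟨F, hc, hd, hv⟩ := aux_F m
  rw [show 2 * (m + 1) - 1 = 2 * m + 1 by omega, Nat.add_sub_cancel, ← hv]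
  refine intervalIntegral.integral_eq_sub_of_hasDerivAt_of_le zero_le_one hc hd ?_
  refine intervalIntegral.intervalIntegrable_deriv_of_nonneg (g := F) ?_ ?_ ?_
  · rwa [Set.uIcc_of_le zero_le_one]
  · simpa using hd
  · intro t ht
    simp at ht
    have h0 : 0 ≤ 1 - t ^ 2 := by nlinarith [ht.1, ht.2]
    have h1 : t ^ (2 * m + 1) ≤ 1 := pow_le_one₀ ht.1.le ht.2.le
    exact div_nonneg (mul_nonneg ht.1.le (by linarith)) (Real.rpow_nonneg h0 _)
end

section
/- For every integer n ≥ 4, (n-1) · ∫₀¹ t^{n-1}/√(1 - t²) dt > ∫₀¹ (t/√(1 - t²)) · (1 - t^{n-2})/(1 - t²) dt. -/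
open Real

lemma aux_base : IntervalIntegrable (fun t : ℝ => 1 / √(1 - t ^ 2)) MeasureTheory.volume 0 1 := by
  apply intervalIntegral.intervalIntegrable_deriv_of_nonneg (g := arcsin)
  · exact continuous_arcsin.continuousOn
  · intro x hx
    simp at hx
    exact hasDerivAt_arcsin (by linarith) (by linarith)
  · intro x hx
    positivity

lemma aux_geom (t : ℝ) (k : ℕ) : 1 - t ^ k = (1 - t) * ∑ i ∈ Finset.range k, t ^ i := by
  have := mul_neg_geom_sum t k
  linarith

theorem stmt_6 (n : ℕ) (hn : 4 ≤ n) :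
    ((n : ℝ) - 1) * ∫ t in (0:ℝ)..1, t ^ (n - 1) / Real.sqrt (1 - t ^ 2) >
      ∫ t in (0:ℝ)..1, (t / Real.sqrt (1 - t ^ 2)) * ((1 - t ^ (n - 2)) / (1 - t ^ 2)) := by
  obtain ⟨k, rfl⟩ : ∃ k, n = k + 2 := ⟨n - 2, by omega⟩
  have e1 : k + 2 - 1 = k + 1 := rfl
  have e2 : k + 2 - 2 = k := rfl
  rw [e1, e2]
  have hf : IntervalIntegrable (fun t : ℝ => t ^ (k + 1) / √(1 - t ^ 2))
      MeasureTheory.volume 0 1 := by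
    have := aux_base.continuousOn_mul (g := fun t : ℝ => t ^ (k + 1)) (by fun_prop)
    simpa [div_eq_mul_inv] using this
  have hg : IntervalIntegrable
      (fun t : ℝ => (t / √(1 - t ^ 2)) * ((1 - t ^ k) / (1 - t ^ 2)))
      MeasureTheory.volume 0 1 := by
    have hc : ContinuousOn (fun t : ℝ => t * (∑ i ∈ Finset.range k, t ^ i) / (1 + t))
        (Set.uIcc 0 1) := by
      apply ContinuousOn.div (by fun_prop) (by fun_prop)
      intro x hx
      rw [Set.uIcc_of_le zero_le_one] at hx
      linarith [hx.1]
    refine (aux_base.continuousOn_mul hc).congr ?_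
    intro t ht
    rw [Set.uIoc_of_le zero_le_one] at ht
    by_cases h1 : t = 1
    · subst h1; simp
    · have h2 : 1 - t ≠ 0 := fun h => h1 (by linarith)
      have h3 : 1 + t ≠ 0 := by linarith [ht.1]
      have h4 : 1 - t ^ 2 = (1 - t) * (1 + t) := by ring
      have h5 : (1 - t ^ k) / (1 - t ^ 2) = (∑ i ∈ Finset.range k, t ^ i) / (1 + t) := by
        rw [aux_geom t k, h4, mul_div_mul_left _ _ h2]
      simp only [h5]
      ring
  have key : ∫ t in (0:ℝ)..1, (((k + 2 : ℕ) : ℝ) - 1) * (t ^ (k + 1) / √(1 - t ^ 2)) -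
      (t / √(1 - t ^ 2)) * ((1 - t ^ k) / (1 - t ^ 2)) = 1 := by
    have := intervalIntegral.integral_eq_sub_of_hasDerivAt_of_le (a := 0) (b := 1)
      (f := fun t : ℝ => -((1 - t ^ (k + 2)) / √(1 - t ^ 2)))
      (f' := fun t : ℝ => (((k + 2 : ℕ) : ℝ) - 1) * (t ^ (k + 1) / √(1 - t ^ 2)) -
      (t / √(1 - t ^ 2)) * ((1 - t ^ k) / (1 - t ^ 2))) zero_le_one ?_ ?_
      ((hf.const_mul _).sub hg)
    · rw [this]; simp
    · have hc : ContinuousOn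
          (fun t : ℝ => -((∑ i ∈ Finset.range (k + 2), t ^ i) * √(1 - t ^ 2) / (1 + t)))
          (Set.Icc 0 1) := by
        apply ContinuousOn.neg
        apply ContinuousOn.div (by fun_prop) (by fun_prop)
        intro x hx
        linarith [hx.1]
      refine hc.congr ?_
      intro t ht
      by_cases h1 : t = 1
      · subst h1; simp
      · have h2 : 0 < 1 - t := by
          have := lt_of_le_of_ne ht.2 h1
          linarith
        have h3 : 0 < 1 + t := by linarith [ht.1]
        have h4 : 0 < 1 - t ^ 2 := by nlinarith
        have h5 := Real.sqrt_pos.2 h4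
        simp only
        rw [aux_geom, neg_inj, div_eq_div_iff h5.ne' h3.ne', mul_assoc _ (√_) (√_),
          Real.mul_self_sqrt h4.le]
        ring
    · intro t ht
      have h4 : 0 < 1 - t ^ 2 := by nlinarith [ht.1, ht.2]
      have h5 := Real.sqrt_pos.2 h4
      have hs : HasDerivAt (fun t : ℝ => 1 - t ^ 2) (-(2 * t)) t := by
        simpa using (hasDerivAt_pow 2 t).const_sub 1
      have hp := (hasDerivAt_pow (k + 2) t).const_sub 1
      refine (hp.div (hs.sqrt h4.ne') h5.ne').neg.congr_deriv ?_
      symm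
      have h6 : √(1 - t ^ 2) ^ 2 = 1 - t ^ 2 := Real.sq_sqrt h4.le
      have e3 : k + 2 - 1 = k + 1 := rfl
      rw [e3]
      set s := √(1 - t ^ 2)
      rw [← h6]
      push_cast
      field_simp
      rw [h6]
      ring
  rw [intervalIntegral.integral_sub (hf.const_mul _) hg,
    intervalIntegral.integral_const_mul] at key
  linarith
end

section
/- For every natural number k ≥ 1, (2k+1) · Γ(k+1)/Γ(k + 3/2) > Σ_{j=0}^{k-1} Γ(j+1)/Γ(j + 3/2). -/
open Real

theorem sum_aux (k : ℕ) :
    ∑ j ∈ Finset.range k, Real.Gamma (j + 1) / Real.Gamma (j + 3/2) =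
    (2 * (k : ℝ) + 1) * (Real.Gamma (k + 1) / Real.Gamma (k + 3/2))
      - Real.Gamma 1 / Real.Gamma (3/2) := by
  induction k with
  | zero => simp
  | succ n ih =>
    rw [Finset.sum_range_succ, ih]
    have hn : (0 : ℝ) ≤ n := Nat.cast_nonneg n
    have h1 : Real.Gamma (((n + 1 : ℕ) : ℝ) + 1) = (n + 1) * Real.Gamma (n + 1) := by
      push_cast
      exact Real.Gamma_add_one (by positivity)
    have h2 : Real.Gamma (((n + 1 : ℕ) : ℝ) + 3/2) = (n + 3/2) * Real.Gamma (n + 3/2) := by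
      rw [← Real.Gamma_add_one (by positivity)]
      push_cast
      congr 1
      ring
    have h3 : Real.Gamma ((n : ℝ) + 3/2) ≠ 0 := (Real.Gamma_pos_of_pos (by positivity)).ne'
    have h4 : (n : ℝ) + 3/2 ≠ 0 := by positivity
    rw [h1, h2, mul_div_mul_comm]
    push_cast
    have h5 : (2 * ((n : ℝ) + 1) + 1) * ((n + 1) / (n + 3/2)) = 2 * (n + 1) := by
      rw [← mul_div_assoc, div_eq_iff h4]
      ring
    rw [← mul_assoc, h5]
    ring

theorem stmt_7 (k : ℕ) (hk : 1 ≤ k) :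
    (2 * (k : ℝ) + 1) * (Real.Gamma (k + 1) / Real.Gamma (k + 3/2)) >
      ∑ j ∈ Finset.range k, Real.Gamma (j + 1) / Real.Gamma (j + 3/2) := by
  rw [sum_aux]
  have : 0 < Real.Gamma 1 / Real.Gamma (3/2) :=
    div_pos (Real.Gamma_pos_of_pos (by norm_num)) (Real.Gamma_pos_of_pos (by norm_num))
  linarith
end

section
/- For every natural number k ≥ 2, k·√π · Γ(k + 1/2)/Γ(k+1) ≥ (√π/2) · Σ_{j=1}^{k-1} Γ(j + 1/2)/Γ(j+1) + (π - 2)/2. -/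
open Real

lemma aux_ratio (n : ℕ) :
    ((n : ℝ) + 1) * (Real.Gamma (((n + 1 : ℕ) : ℝ) + 1/2) / Real.Gamma (((n + 1 : ℕ) : ℝ) + 1)) =
      ((n : ℝ) + 1/2) * (Real.Gamma (n + 1/2) / Real.Gamma (n + 1)) := by
  have hn : (0 : ℝ) ≤ n := Nat.cast_nonneg n
  have h1 : Real.Gamma (((n + 1 : ℕ) : ℝ) + 1/2) = ((n : ℝ) + 1/2) * Real.Gamma (n + 1/2) := by
    rw [← Real.Gamma_add_one (by positivity)]
    congr 1
    push_cast
    ring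
  have h2 : Real.Gamma (((n + 1 : ℕ) : ℝ) + 1) = ((n : ℝ) + 1) * Real.Gamma (n + 1) := by
    rw [← Real.Gamma_add_one (by positivity)]
    congr 1
    push_cast
    ring
  have h3 : Real.Gamma ((n : ℝ) + 1) ≠ 0 := (Real.Gamma_pos_of_pos (by positivity)).ne'
  have h4 : (n : ℝ) + 1 ≠ 0 := by positivity
  rw [h1, h2]
  field_simp

lemma aux_sum (n : ℕ) :
    ((n : ℝ) + 1) * (Real.Gamma (((n + 1 : ℕ) : ℝ) + 1/2) / Real.Gamma (((n + 1 : ℕ) : ℝ) + 1)) =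
      1/2 * ∑ j ∈ Finset.Icc 1 n, Real.Gamma (j + 1/2) / Real.Gamma (j + 1)
        + Real.sqrt π / 2 := by
  induction n with
  | zero =>
    rw [aux_ratio]
    have h := Real.Gamma_one_half_eq
    simp only [Nat.cast_zero, zero_add, Real.Gamma_one, h]
    simp
    ring
  | succ m ih =>
    rw [aux_ratio, Finset.sum_Icc_succ_top (by omega)]
    have : (((m + 1 : ℕ) : ℝ)) = (m : ℝ) + 1 := by push_cast; ring
    rw [mul_add, add_right_comm, ← ih, add_mul]
    congr 1
    rw [this]

theorem stmt_8 (k : ℕ) (hk : 2 ≤ k) :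
    (k : ℝ) * Real.sqrt π * (Real.Gamma (k + 1/2) / Real.Gamma (k + 1)) ≥
      (Real.sqrt π / 2) *
        ∑ j ∈ Finset.Icc 1 (k - 1), Real.Gamma (j + 1/2) / Real.Gamma (j + 1)
      + (π - 2) / 2 := by
  obtain ⟨n, rfl⟩ : ∃ n, k = n + 1 := ⟨k - 1, by omega⟩
  have h := aux_sum n
  have hs : Real.sqrt π * Real.sqrt π = π := Real.mul_self_sqrt Real.pi_pos.le
  have hc : (((n + 1 : ℕ) : ℝ)) * Real.sqrt π *
      (Real.Gamma (((n + 1 : ℕ) : ℝ) + 1/2) / Real.Gamma (((n + 1 : ℕ) : ℝ) + 1)) =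
      Real.sqrt π * (((n : ℝ) + 1) *
      (Real.Gamma (((n + 1 : ℕ) : ℝ) + 1/2) / Real.Gamma (((n + 1 : ℕ) : ℝ) + 1))) := by
    push_cast
    ring
  rw [hc, h, Nat.add_sub_cancel]
  linarith
end

section
/- Let n ≥ 3 be an integer, let r > 0, and let f : [0,r] → ℝ be twice continuously differentiable with f(0) = 0, f(t) > 0 for t ∈ (0,r], and f'(t) ≥ 0 on [0,r]. If on (0,r] the inequality -2f''(t)/f(t) + (n-2)/f(t)² - (n-2)·f'(t)²/f(t)² ≥ n holds, then the function F(t) = f(t)^{n-2}·(1 - f'(t)² - f(t)²) is monotone nondecreasing on [0,r]. -/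
open Real Set

theorem stmt_11 (n : ℕ) (hn : 3 ≤ n) (r : ℝ) (hr : 0 < r)
    (f : ℝ → ℝ) (hf : ContDiff ℝ 2 f)
    (hf0 : f 0 = 0) (hfpos : ∀ t ∈ Set.Ioc 0 r, 0 < f t)
    (hf' : ∀ t ∈ Set.Icc 0 r, 0 ≤ deriv f t)
    (hscal : ∀ t ∈ Set.Ioc 0 r,
      -(2 * deriv (deriv f) t) / f t + (n - 2 : ℝ) / f t ^ 2
        - (n - 2 : ℝ) * (deriv f t) ^ 2 / f t ^ 2 ≥ (n : ℝ)) :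
    MonotoneOn (fun t => f t ^ (n - 2) * (1 - (deriv f t) ^ 2 - f t ^ 2))
      (Set.Icc 0 r) := by
  obtain ⟨m, rfl⟩ := Nat.exists_eq_add_of_le' hn
  have hd : Differentiable ℝ f := hf.differentiable (by norm_num)
  have hd1 : ContDiff ℝ 1 (deriv f) := by
    have h2 : ContDiff ℝ (1 + 1) f := by
      have : (1 + 1 : WithTop ℕ∞) = 2 := by norm_num
      rwa [this]
    exact (contDiff_succ_iff_deriv.1 h2).2.2
  have hd2 : Differentiable ℝ (deriv f) := hd1.differentiable (by norm_num)
  have e : m + 3 - 2 = m + 1 := by omega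
  rw [e]
  have hD : ∀ t, HasDerivAt (fun t => f t ^ (m + 1) * (1 - (deriv f t) ^ 2 - f t ^ 2))
      (f t ^ m * deriv f t * ((m + 1) * (1 - (deriv f t) ^ 2) - (m + 3) * f t ^ 2
        - 2 * f t * deriv (deriv f) t)) t := by
    intro t
    have h1 := (hd t).hasDerivAt
    have h2 := (hd2 t).hasDerivAt
    refine HasDerivAt.congr_deriv ((h1.fun_pow (m + 1)).fun_mul (((h2.fun_pow 2).const_sub 1).fun_sub (h1.fun_pow 2))) ?_
    rw [show m + 1 - 1 = m from rfl]
    push_cast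
    ring
  apply monotoneOn_of_deriv_nonneg (convex_Icc 0 r)
  · exact fun t _ => (hD t).continuousAt.continuousWithinAt
  · exact fun t _ => (hD t).differentiableAt.differentiableWithinAt
  · intro t ht
    rw [interior_Icc] at ht
    have ht' : t ∈ Set.Ioc 0 r := ⟨ht.1, ht.2.le⟩
    rw [(hD t).deriv]
    have hp := hfpos t ht'
    have hs := hscal t ht'
    have h0 := hf' t ⟨ht.1.le, ht.2.le⟩
    refine mul_nonneg (mul_nonneg (pow_nonneg hp.le _) h0) ?_
    have hq := mul_le_mul_of_nonneg_right hs (sq_nonneg (f t))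
    have hE : (-(2 * deriv (deriv f) t) / f t + (((m + 3 : ℕ) : ℝ) - 2) / f t ^ 2
        - (((m + 3 : ℕ) : ℝ) - 2) * (deriv f t) ^ 2 / f t ^ 2) * f t ^ 2
        = -(2 * deriv (deriv f) t) * f t + (((m + 3 : ℕ) : ℝ) - 2)
          - (((m + 3 : ℕ) : ℝ) - 2) * (deriv f t) ^ 2 := by
      field_simp
    rw [hE] at hq
    push_cast at hq
    linarith
end

section
/- Let n ≥ 3 be an integer, let r > 0, and let f : [0,r] → ℝ be twice continuously differentiable with f(0) = 0, f(t) > 0 for t ∈ (0,r], and f'(t) ≥ 0 on [0,r]. If on (0,r] the inequality -2f''(t)/f(t) + (n-2)/f(t)² - (n-2)·f'(t)²/f(t)² ≥ n holds, then f(t)² + f'(t)² ≤ 1 for all t ∈ [0,r]. -/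
open Real Set

theorem stmt_12 (n : ℕ) (hn : 3 ≤ n) (r : ℝ) (hr : 0 < r)
    (f : ℝ → ℝ) (hf : ContDiff ℝ 2 f)
    (hf0 : f 0 = 0) (hfpos : ∀ t ∈ Set.Ioc 0 r, 0 < f t)
    (hf' : ∀ t ∈ Set.Icc 0 r, 0 ≤ deriv f t)
    (hscal : ∀ t ∈ Set.Ioc 0 r,
      -(2 * deriv (deriv f) t) / f t + (n - 2 : ℝ) / f t ^ 2
        - (n - 2 : ℝ) * (deriv f t) ^ 2 / f t ^ 2 ≥ (n : ℝ)) :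
    ∀ t ∈ Set.Icc 0 r, f t ^ 2 + (deriv f t) ^ 2 ≤ 1 := by
  obtain ⟨m, rfl⟩ : ∃ m, n = m + 3 := ⟨n - 3, by omega⟩
  have hd1 : ∀ t, HasDerivAt f (deriv f t) t := fun t =>
    (hf.differentiable (by norm_num) t).hasDerivAt
  have hf1 : ContDiff ℝ 1 (deriv f) := by
    have h : ContDiff ℝ (1 + 1) f := by
      rw [one_add_one_eq_two]; exact hf
    exact (contDiff_succ_iff_deriv.1 h).2.2
  have hd2 : ∀ t, HasDerivAt (deriv f) (deriv (deriv f) t) t := fun t =>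
    (hf1.differentiable (by norm_num) t).hasDerivAt
  have hG : ∀ t, HasDerivAt (fun t => f t ^ (m + 1) * (1 - deriv f t ^ 2 - f t ^ 2))
      (f t ^ m * deriv f t * (((m : ℝ) + 1) * (1 - deriv f t ^ 2 - f t ^ 2)
        - 2 * f t * deriv (deriv f) t - 2 * f t ^ 2)) t := by
    intro t
    have h := ((hd1 t).pow (m + 1)).mul
      ((((hd2 t).pow 2).const_sub 1).sub ((hd1 t).pow 2))
    refine h.congr_deriv ?_
    simp
    ring
  have hcont : Continuous (fun t => f t ^ (m + 1) * (1 - deriv f t ^ 2 - f t ^ 2)) :=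
    continuous_iff_continuousAt.2 fun t => (hG t).continuousAt
  have hmono : MonotoneOn (fun t => f t ^ (m + 1) * (1 - deriv f t ^ 2 - f t ^ 2))
      (Icc 0 r) := by
    refine monotoneOn_of_deriv_nonneg (convex_Icc 0 r) hcont.continuousOn
      (fun t _ => (hG t).differentiableAt.differentiableWithinAt) ?_
    intro t ht
    rw [interior_Icc] at ht
    rw [(hG t).deriv]
    have hp := hfpos t ⟨ht.1, ht.2.le⟩
    have hs := hscal t ⟨ht.1, ht.2.le⟩
    have hd := hf' t ⟨ht.1.le, ht.2.le⟩
    refine mul_nonneg (mul_nonneg (pow_nonneg hp.le _) hd) ?_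
    have h2 := mul_le_mul_of_nonneg_right hs (sq_nonneg (f t))
    have e : (-(2 * deriv (deriv f) t) / f t + (((m + 3 : ℕ) : ℝ) - 2) / f t ^ 2
        - (((m + 3 : ℕ) : ℝ) - 2) * (deriv f t) ^ 2 / f t ^ 2) * f t ^ 2
        = -(2 * deriv (deriv f) t) * f t + (((m + 3 : ℕ) : ℝ) - 2)
        - (((m + 3 : ℕ) : ℝ) - 2) * (deriv f t) ^ 2 := by
      field_simp
    rw [e] at h2
    push_cast at h2
    linarith
  have key : ∀ t ∈ Ioc 0 r, f t ^ 2 + (deriv f t) ^ 2 ≤ 1 := by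
    intro t ht
    have h := hmono (left_mem_Icc.2 hr.le) ⟨ht.1.le, ht.2⟩ ht.1.le
    simp only [hf0] at h
    have h0 : (0 : ℝ) ^ (m + 1) = 0 := by simp
    rw [h0, zero_mul] at h
    have := nonneg_of_mul_nonneg_right h (pow_pos (hfpos t ht) (m + 1))
    linarith
  have hcl : IsClosed {t | f t ^ 2 + (deriv f t) ^ 2 ≤ 1} :=
    isClosed_le ((hf.continuous.pow 2).add (hf1.continuous.pow 2)) continuous_const
  intro t ht
  rw [← closure_Ioc hr.ne] at ht
  exact closure_minimal (fun x hx => key x hx) hcl ht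
end

section
/- Let ε > 0, let r > 0, and let f : [0,r] → ℝ be twice continuously differentiable with f ≥ 0 and f' ≥ 0 on [0,r], f'(r) = 0, satisfying f''(t) ≤ -ε·f(t) on [0,r]. Set m = f(r). Then for every t ∈ [0,r], f'(t)² ≥ ε·(m² - f(t)²), i.e. f'(t) ≥ √(ε·(m² - f(t)²)). -/
open Real Set

theorem stmt_15 (ε : ℝ) (hε : 0 < ε) (r : ℝ) (hr : 0 < r)
    (f : ℝ → ℝ) (hf : ContDiff ℝ 2 f)
    (hfpos : ∀ t ∈ Set.Icc 0 r, 0 ≤ f t)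
    (hf' : ∀ t ∈ Set.Icc 0 r, 0 ≤ deriv f t)
    (hf'r : deriv f r = 0)
    (hf'' : ∀ t ∈ Set.Icc 0 r, deriv (deriv f) t ≤ -ε * f t) :
    ∀ t ∈ Set.Icc 0 r,
      (deriv f t) ^ 2 ≥ ε * ((f r) ^ 2 - f t ^ 2) ∧
      deriv f t ≥ Real.sqrt (ε * ((f r) ^ 2 - f t ^ 2)) := by
  have hd : ∀ x, HasDerivAt f (deriv f x) x := fun x =>
    (hf.differentiable (by norm_num) x).hasDerivAt
  have hc : ContDiff ℝ 1 (deriv f) := by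
    have h2 : ContDiff ℝ (1 + 1) f := by
      have he : (1 + 1 : WithTop ℕ∞) = 2 := by norm_num
      rw [he]; exact hf
    exact (contDiff_succ_iff_deriv.mp h2).2.2
  have hdd : ∀ x, HasDerivAt (deriv f) (deriv (deriv f) x) x := fun x =>
    (hc.differentiable (by norm_num) x).hasDerivAt
  have hg : ∀ x, HasDerivAt (fun y => ε * f y ^ 2 + deriv f y ^ 2)
      (2 * deriv f x * (ε * f x + deriv (deriv f) x)) x := by
    intro x
    have h := (((hd x).pow 2).const_mul ε).add ((hdd x).pow 2)
    refine h.congr_deriv ?_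
    norm_num
    ring
  have hanti : AntitoneOn (fun y => ε * f y ^ 2 + deriv f y ^ 2) (Set.Icc 0 r) := by
    refine antitoneOn_of_deriv_nonpos (convex_Icc 0 r)
      (fun x _ => (hg x).continuousAt.continuousWithinAt)
      (fun x _ => (hg x).differentiableAt.differentiableWithinAt) ?_
    intro x hx
    have hx' := interior_subset hx
    rw [(hg x).deriv]
    have h1 := hf' x hx'
    have h2 := hf'' x hx'
    exact mul_nonpos_of_nonneg_of_nonpos (by linarith) (by linarith)
  intro t ht
  have h := hanti ht (Set.right_mem_Icc.mpr hr.le) ht.2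
  simp only [hf'r] at h
  have key : (deriv f t) ^ 2 ≥ ε * ((f r) ^ 2 - f t ^ 2) := by linarith
  exact ⟨key, Real.sqrt_le_iff.mpr ⟨hf' t ht, key⟩⟩
end

section
/- Let n ≥ 3 be an integer, let r > 0, and let f : [0,r] → ℝ be twice continuously differentiable with f(0) = 0, f(t) > 0 for t ∈ (0,r], f' ≥ 0 on [0,r], and f'(r) = 0, satisfying on (0,r] the inequality -2f''(t)/f(t) + (n-2)/f(t)² - (n-2)·f'(t)²/f(t)² ≥ n. Set m = f(r). Then for every t ∈ (0,r], f'(t)² ≥ 1 - f(t)² - m^{n-2}·(1 - m²)/f(t)^{n-2}. -/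
open Real Set

theorem stmt_16 (n : ℕ) (hn : 3 ≤ n) (r : ℝ) (hr : 0 < r)
    (f : ℝ → ℝ) (hf : ContDiff ℝ 2 f)
    (hf0 : f 0 = 0) (hfpos : ∀ t ∈ Set.Ioc 0 r, 0 < f t)
    (hf' : ∀ t ∈ Set.Icc 0 r, 0 ≤ deriv f t)
    (hf'r : deriv f r = 0)
    (hscal : ∀ t ∈ Set.Ioc 0 r,
      -(2 * deriv (deriv f) t) / f t + (n - 2 : ℝ) / f t ^ 2
        - (n - 2 : ℝ) * (deriv f t) ^ 2 / f t ^ 2 ≥ (n : ℝ)) :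
    ∀ t ∈ Set.Ioc 0 r,
      (deriv f t) ^ 2 ≥ 1 - f t ^ 2 - (f r) ^ (n - 2) * (1 - (f r) ^ 2) / f t ^ (n - 2) := by
  obtain ⟨k, rfl⟩ : ∃ k, n = k + 3 := ⟨n - 3, by omega⟩
  have e : k + 3 - 2 = k + 1 := by omega
  rw [e]
  intro t ht
  have hd : ∀ x, HasDerivAt f (deriv f x) x := fun x =>
    (hf.differentiable (by norm_num) x).hasDerivAt
  have hf1 : ContDiff ℝ 1 (deriv f) := by
    have h2 : ContDiff ℝ (1 + 1) f := by
      convert hf using 1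
      norm_num
    exact (contDiff_succ_iff_deriv.1 h2).2.2
  have hd2 : ∀ x, HasDerivAt (deriv f) (deriv (deriv f) x) x := fun x =>
    (hf1.differentiable (by norm_num) x).hasDerivAt
  have hF : ∀ x, HasDerivAt (fun x => f x ^ (k + 1) * (1 - deriv f x ^ 2 - f x ^ 2))
      (f x ^ k * deriv f x * ((k + 1) * (1 - deriv f x ^ 2) - 2 * f x * deriv (deriv f) x
        - (k + 3) * f x ^ 2)) x := by
    intro x
    have h := ((hd x).pow (k + 1)).mul ((((hd2 x).pow 2).const_sub 1).sub ((hd x).pow 2))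
    refine h.congr_deriv ?_
    simp only [Pi.pow_apply, Pi.sub_apply, Nat.add_sub_cancel]
    push_cast
    ring
  have hmono : MonotoneOn (fun x => f x ^ (k + 1) * (1 - deriv f x ^ 2 - f x ^ 2))
      (Set.Icc t r) := by
    apply monotoneOn_of_deriv_nonneg (convex_Icc t r)
    · exact fun x _ => (hF x).continuousAt.continuousWithinAt
    · exact fun x _ => (hF x).differentiableAt.differentiableWithinAt
    · intro x hx
      rw [interior_Icc] at hx
      rw [(hF x).deriv]
      have hx0 : 0 < x := ht.1.trans hx.1
      have hp := hfpos x ⟨hx0, hx.2.le⟩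
      have hs := hscal x ⟨hx0, hx.2.le⟩
      have hs2 := mul_le_mul_of_nonneg_right hs (sq_nonneg (f x))
      have e2 : (-(2 * deriv (deriv f) x) / f x + (((k + 3 : ℕ) : ℝ) - 2) / f x ^ 2
        - (((k + 3 : ℕ) : ℝ) - 2) * (deriv f x) ^ 2 / f x ^ 2) * f x ^ 2
        = (k + 1) * (1 - deriv f x ^ 2) - 2 * f x * deriv (deriv f) x := by
        push_cast
        field_simp
        ring
      rw [e2] at hs2
      push_cast at hs2
      exact mul_nonneg (mul_nonneg (pow_nonneg hp.le _) (hf' x ⟨hx0.le, hx.2.le⟩))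
        (by linarith)
  have h := hmono (Set.left_mem_Icc.2 ht.2) (Set.right_mem_Icc.2 ht.2) ht.2
  simp only [hf'r] at h
  have hp : 0 < f t ^ (k + 1) := pow_pos (hfpos t ht) _
  have : 1 - deriv f t ^ 2 - f t ^ 2 ≤ f r ^ (k + 1) * (1 - f r ^ 2) / f t ^ (k + 1) := by
    rw [le_div_iff₀ hp]
    linarith
  linarith
end

section
/- Let n ≥ 3 be an integer, ε ∈ (0,1], r > 0, and let f : [0,r] → ℝ be continuously differentiable with f(0) = 0, f(r) = m > 0, f'(t) > 0 for t ∈ (0,r), and f'(t) ≥ √(ε·(m² - f(t)²)) for all t ∈ [0,r]. If m^{n-1} ≤ √ε, then ∫₀ʳ f(t)^{n-1} dt ≤ ∫₀¹ t^{n-1}/√(1 - t²) dt. -/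
open Real Set MeasureTheory

theorem stmt_17 (n : ℕ) (hn : 3 ≤ n) (ε : ℝ) (hε : ε ∈ Set.Ioc (0:ℝ) 1)
    (r : ℝ) (hr : 0 < r) (m : ℝ) (hm : 0 < m)
    (f : ℝ → ℝ) (hf : ContDiff ℝ 1 f)
    (hf0 : f 0 = 0) (hfr : f r = m)
    (hf'pos : ∀ t ∈ Set.Ioo 0 r, 0 < deriv f t)
    (hf'lb : ∀ t ∈ Set.Icc 0 r,
      deriv f t ≥ Real.sqrt (ε * (m ^ 2 - f t ^ 2)))
    (hmsmall : m ^ (n - 1) ≤ Real.sqrt ε) :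
    ∫ t in (0:ℝ)..r, f t ^ (n - 1) ≤
      ∫ t in (0:ℝ)..1, t ^ (n - 1) / Real.sqrt (1 - t ^ 2) := by
  obtain ⟨hε0, hε1⟩ := hε
  set k := n - 1 with hk
  have hsε : 0 < √ε := Real.sqrt_pos.2 hε0
  have hdiff : Differentiable ℝ f := hf.differentiable (by norm_num)
  have hmono : StrictMonoOn f (Icc 0 r) := by
    apply strictMonoOn_of_deriv_pos (convex_Icc 0 r) hdiff.continuous.continuousOn
    rw [interior_Icc]; exact hf'pos
  have hrange : ∀ t ∈ Ioo 0 r, 0 < f t ∧ f t < m := by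
    intro t ht
    constructor
    · rw [← hf0]; exact hmono ⟨le_rfl, hr.le⟩ ⟨ht.1.le, ht.2.le⟩ ht.1
    · rw [← hfr]; exact hmono ⟨ht.1.le, ht.2.le⟩ ⟨hr.le, le_rfl⟩ ht.2
  let g : ℝ → ℝ := fun t => f t / m
  let h : ℝ → ℝ := fun u => u ^ k / √(1 - u ^ 2)
  have himg : g '' Ioo 0 r = Ioo 0 1 := by
    apply Subset.antisymm
    · rintro _ ⟨t, ht, rfl⟩
      obtain ⟨h1, h2⟩ := hrange t ht
      exact ⟨div_pos h1 hm, (div_lt_one hm).2 h2⟩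
    · have := intermediate_value_Ioo (f := g) hr.le
        (hdiff.continuous.div_const m).continuousOn
      simpa [g, hf0, hfr, hm.ne'] using this
  have hinj : InjOn g (Ioo 0 r) := by
    intro a ha b hb hab
    have : f a = f b := by
      have h3 : f a / m = f b / m := hab
      field_simp at h3
      exact h3
    exact hmono.injOn (Ioo_subset_Icc_self ha) (Ioo_subset_Icc_self hb) this
  have hder : ∀ t ∈ Ioo 0 r, HasDerivWithinAt g (deriv f t / m) (Ioo 0 r) t := by
    intro t _
    exact ((hdiff t).hasDerivAt.div_const m).hasDerivWithinAt
  have harc : IntegrableOn (fun u : ℝ => 1 / √(1 - u ^ 2)) (Ioo 0 1) volume := by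
    have := intervalIntegral.integrableOn_deriv_of_nonneg (a := 0) (b := 1) (g := arcsin)
      (g' := fun u : ℝ => 1 / √(1 - u ^ 2)) continuous_arcsin.continuousOn
      (fun x hx => hasDerivAt_arcsin (by linarith [hx.1]) (by linarith [hx.2]))
      (fun x _ => by positivity)
    exact this.mono_set Ioo_subset_Ioc_self
  have hint : IntegrableOn h (Ioo 0 1) volume := by
    refine Integrable.mono' harc ?_ ?_
    · apply Measurable.aestronglyMeasurable
      fun_prop
    · filter_upwards [ae_restrict_mem measurableSet_Ioo] with u hu
      have h0 : 0 ≤ u ^ k := pow_nonneg hu.1.le k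
      have h1 : u ^ k ≤ 1 := pow_le_one₀ hu.1.le hu.2.le
      rw [Real.norm_of_nonneg (by positivity)]
      simp only [h]
      gcongr
  have hcv := integral_image_eq_integral_abs_deriv_smul measurableSet_Ioo hder hinj h
  have hint2 := (integrableOn_image_iff_integrableOn_abs_deriv_smul
    measurableSet_Ioo hder hinj h).1 (by rw [himg]; exact hint)
  rw [himg] at hcv
  rw [intervalIntegral.integral_of_le hr.le, intervalIntegral.integral_of_le zero_le_one,
    integral_Ioc_eq_integral_Ioo, integral_Ioc_eq_integral_Ioo]
  change _ ≤ ∫ u in Ioo 0 1, h u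
  rw [hcv]
  refine setIntegral_mono_on ?_ hint2 measurableSet_Ioo ?_
  · exact ((hdiff.continuous.pow k).integrableOn_Icc).mono_set Ioo_subset_Icc_self
  · intro t ht
    obtain ⟨h1, h2⟩ := hrange t ht
    have hd := hf'pos t ht
    have hlb := hf'lb t (Ioo_subset_Icc_self ht)
    have hg0 : 0 < g t := div_pos h1 hm
    have hg1 : g t < 1 := (div_lt_one hm).2 h2
    have hfg : f t = m * g t := by simp only [g]; field_simp
    have hq : 0 < √(1 - g t ^ 2) := Real.sqrt_pos.2 (by nlinarith)
    have hs : √(ε * (m ^ 2 - f t ^ 2)) = m * (√ε * √(1 - g t ^ 2)) := by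
      rw [hfg, show ε * (m ^ 2 - (m * g t) ^ 2) = m ^ 2 * (ε * (1 - g t ^ 2)) by ring,
        Real.sqrt_mul (by positivity), Real.sqrt_sq hm.le, Real.sqrt_mul hε0.le]
    rw [hs] at hlb
    have hlb2 : √ε * √(1 - g t ^ 2) ≤ deriv f t / m := by
      rw [le_div_iff₀ hm]; linarith
    rw [abs_of_pos (div_pos hd hm), smul_eq_mul]
    calc f t ^ k = m ^ k * g t ^ k := by rw [hfg, mul_pow]
      _ ≤ √ε * g t ^ k := by gcongr
      _ = (√ε * √(1 - g t ^ 2)) * h (g t) := by simp only [h]; field_simp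
      _ ≤ deriv f t / m * h (g t) := by
        gcongr
end
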